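/- arXiv:2402.06956 — 3 statements merged into one kernel-verified Lean document; each statement's English description precedes it below -/
import Mathlib

section
/- For every ν ≥ 0 and every x > ν, the derivative of θlo_ν is given by θlo'_ν(x) = (8x⁶ + (1 − 24ν²)x⁴ + 4(6ν⁴ + ν²)x² − 8ν⁶)/(8x(x² − ν²)^{5/2}), and this expression is strictly positive; consequently θlo_ν is strictly monotone increasing on (ν, ∞). -/
/-- The lower bound for the Bessel phase function:
`θlo_ν(x) := √(x² − ν²) − ν·arccos(ν/x) − π/4 − (3x² + 2ν²)/(24(x² − ν²)^{3/2})`. -/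
noncomputable def thetaLo (ν x : ℝ) : ℝ :=
  Real.sqrt (x ^ 2 - ν ^ 2) - ν * Real.arccos (ν / x) - Real.pi / 4
    - (3 * x ^ 2 + 2 * ν ^ 2) / (24 * Real.sqrt (x ^ 2 - ν ^ 2) ^ 3)

/-- The closed form of the derivative of `θlo_ν` is positive for `x > ν`. -/
lemma thetaLo_deriv_pos {ν x : ℝ} (hν : 0 ≤ ν) (hx : ν < x) :
    0 < (8 * x ^ 6 + (1 - 24 * ν ^ 2) * x ^ 4 + 4 * (6 * ν ^ 4 + ν ^ 2) * x ^ 2 - 8 * ν ^ 6)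
      / (8 * x * Real.sqrt (x ^ 2 - ν ^ 2) ^ 5) := by
  have hx0 : 0 < x := hν.trans_lt hx
  have hd : 0 < x ^ 2 - ν ^ 2 := by nlinarith
  have hs : 0 < Real.sqrt (x ^ 2 - ν ^ 2) := Real.sqrt_pos.2 hd
  have hnum : 8 * x ^ 6 + (1 - 24 * ν ^ 2) * x ^ 4 + 4 * (6 * ν ^ 4 + ν ^ 2) * x ^ 2 - 8 * ν ^ 6
      = 8 * (x ^ 2 - ν ^ 2) ^ 3 + x ^ 4 + 4 * ν ^ 2 * x ^ 2 := by ring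
  rw [hnum]
  positivity

lemma hasDerivAt_thetaLo {ν x : ℝ} (hν : 0 ≤ ν) (hx : ν < x) :
    HasDerivAt (thetaLo ν)
      ((8 * x ^ 6 + (1 - 24 * ν ^ 2) * x ^ 4 + 4 * (6 * ν ^ 4 + ν ^ 2) * x ^ 2 - 8 * ν ^ 6)
        / (8 * x * Real.sqrt (x ^ 2 - ν ^ 2) ^ 5)) x := by
  have hx0 : 0 < x := hν.trans_lt hx
  have hd : 0 < x ^ 2 - ν ^ 2 := by nlinarith
  have hs : 0 < Real.sqrt (x ^ 2 - ν ^ 2) := Real.sqrt_pos.2 hd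
  have hsq : Real.sqrt (x ^ 2 - ν ^ 2) ^ 2 = x ^ 2 - ν ^ 2 := Real.sq_sqrt hd.le
  have hsqrt : HasDerivAt (fun y => Real.sqrt (y ^ 2 - ν ^ 2))
      (x / Real.sqrt (x ^ 2 - ν ^ 2)) x := by
    refine (((hasDerivAt_pow 2 x).sub_const (ν ^ 2)).sqrt hd.ne').congr_deriv ?_
    simp
    field_simp
  have hroot : Real.sqrt (1 - (ν / x) ^ 2) = Real.sqrt (x ^ 2 - ν ^ 2) / x := by
    rw [show 1 - (ν / x) ^ 2 = (x ^ 2 - ν ^ 2) / x ^ 2 by field_simp,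
      Real.sqrt_div hd.le, Real.sqrt_sq hx0.le]
  have harccos : HasDerivAt (fun y => Real.arccos (ν / y))
      (ν / (x * Real.sqrt (x ^ 2 - ν ^ 2))) x := by
    have hne : ν / x ≠ -1 := by
      have : 0 ≤ ν / x := by positivity
      linarith
    have hne' : ν / x ≠ 1 := ((div_lt_one hx0).2 hx).ne
    refine ((Real.hasDerivAt_arccos hne hne').comp x
      ((hasDerivAt_const x ν).fun_div (hasDerivAt_id' x) hx0.ne')).congr_deriv ?_
    rw [hroot]
    field_simp
    simp
  have hnum : HasDerivAt (fun y : ℝ => 3 * y ^ 2 + 2 * ν ^ 2) (6 * x) x := by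
    refine (((hasDerivAt_pow 2 x).const_mul 3).add_const (2 * ν ^ 2)).congr_deriv ?_
    simp
    ring
  have hquot := hnum.fun_div ((hsqrt.fun_pow 3).const_mul 24) (by positivity)
  refine (((hsqrt.fun_sub (harccos.const_mul ν)).sub_const (Real.pi / 4)).fun_sub
    hquot).congr_deriv ?_
  generalize Real.sqrt (x ^ 2 - ν ^ 2) = s at hs hsq
  have hν2 : ν ^ 2 = x ^ 2 - s ^ 2 := by linarith
  have hν6 : ν ^ 6 = (x ^ 2 - s ^ 2) ^ 3 := by rw [← hν2]; ring
  field_simp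
  rw [hν6, hν2]
  push_cast
  ring

/-- The explicit formula for the derivative of `θlo_ν`, its positivity, and the resulting
strict monotonicity of `θlo_ν` on `(ν, ∞)`. -/
theorem thetaLo_deriv_and_strictMono (ν : ℝ) (hν : 0 ≤ ν) :
    (∀ x, ν < x →
      deriv (thetaLo ν) x
        = (8 * x ^ 6 + (1 - 24 * ν ^ 2) * x ^ 4 + 4 * (6 * ν ^ 4 + ν ^ 2) * x ^ 2 - 8 * ν ^ 6)
          / (8 * x * Real.sqrt (x ^ 2 - ν ^ 2) ^ 5) ∧
      0 < (8 * x ^ 6 + (1 - 24 * ν ^ 2) * x ^ 4 + 4 * (6 * ν ^ 4 + ν ^ 2) * x ^ 2 - 8 * ν ^ 6)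
          / (8 * x * Real.sqrt (x ^ 2 - ν ^ 2) ^ 5)) ∧
    StrictMonoOn (thetaLo ν) (Set.Ioi ν) := by
  refine ⟨fun x hx => ⟨(hasDerivAt_thetaLo hν hx).deriv, thetaLo_deriv_pos hν hx⟩, ?_⟩
  refine strictMonoOn_of_deriv_pos (convex_Ioi ν)
    (fun x hx => (hasDerivAt_thetaLo hν hx).continuousAt.continuousWithinAt) fun x hx => ?_
  rw [interior_Ioi] at hx
  rw [(hasDerivAt_thetaLo hν hx).deriv]
  exact thetaLo_deriv_pos hν hx
end

section
/- For every ν ≥ 0 and every x > ν, V_{θlo_ν}(x) > 1 − (ν² − 1/4)/x². -/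
/-- The potential `V_f` associated with a function `f` via Liouville's transformation. -/
noncomputable def potential (f : ℝ → ℝ) (x : ℝ) : ℝ :=
  (deriv f x) ^ 2 + (1 / 2) * (deriv (deriv (deriv f)) x / deriv f x)
    - (3 / 4) * (deriv (deriv f) x / deriv f x) ^ 2

open Filter Topology in
/-- If `f' = g`, `g' = g * L` and `L' = M` near `x`, with `g x ≠ 0`, then the potential of `f` at `x`
is expressed through `g` and its logarithmic derivative `L`. -/
theorem potential_eq_of_logDeriv {f g L : ℝ → ℝ} {M x : ℝ}
    (hf : ∀ᶠ y in 𝓝 x, HasDerivAt f (g y) y)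
    (hg : ∀ᶠ y in 𝓝 x, HasDerivAt g (g y * L y) y)
    (hL : HasDerivAt L M x) (hx : g x ≠ 0) :
    potential f x = g x ^ 2 + M / 2 - L x ^ 2 / 4 := by
  have h1 : deriv f =ᶠ[𝓝 x] g := hf.mono fun y hy => hy.deriv
  have h2 : deriv (deriv f) =ᶠ[𝓝 x] fun y => g y * L y := by
    filter_upwards [h1.eventuallyEq_nhds, hg] with y hy hgy
    rw [hy.deriv_eq, hgy.deriv]
  have h3 : deriv (deriv (deriv f)) x = g x * L x * L x + g x * M := by
    rw [h2.deriv_eq, (hg.self_of_nhds.fun_mul hL).deriv]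
  rw [potential, h1.self_of_nhds, h2.self_of_nhds, h3]
  field_simp
  ring

theorem hasDerivAt_sqrt_sq_sub_sq {ν x : ℝ} (hW : 0 < x ^ 2 - ν ^ 2) :
    HasDerivAt (fun y => Real.sqrt (y ^ 2 - ν ^ 2)) (x / Real.sqrt (x ^ 2 - ν ^ 2)) x := by
  refine (((hasDerivAt_pow 2 x).sub_const (ν ^ 2)).sqrt hW.ne').congr_deriv ?_
  push_cast
  ring

/-- The numerator of the derivative of `thetaLo ν`. -/
noncomputable def thetaLoNum (ν x : ℝ) : ℝ :=
  8 * (x ^ 2 - ν ^ 2) ^ 3 + x ^ 2 * (x ^ 2 + 4 * ν ^ 2)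

/-- The derivative of `thetaLo ν`. -/
noncomputable def thetaLoDeriv (ν x : ℝ) : ℝ :=
  thetaLoNum ν x / (8 * x * Real.sqrt (x ^ 2 - ν ^ 2) ^ 5)

/-- The derivative of `thetaLoNum ν`. -/
noncomputable def thetaLoNumDeriv (ν x : ℝ) : ℝ :=
  48 * x * (x ^ 2 - ν ^ 2) ^ 2 + 4 * x ^ 3 + 8 * ν ^ 2 * x

/-- The logarithmic derivative of `thetaLoDeriv ν`. -/
noncomputable def thetaLoLogDeriv (ν x : ℝ) : ℝ :=
  thetaLoNumDeriv ν x / thetaLoNum ν x - 1 / x - 5 * x / (x ^ 2 - ν ^ 2)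

theorem thetaLoNum_pos {ν x : ℝ} (hW : 0 < x ^ 2 - ν ^ 2) : 0 < thetaLoNum ν x := by
  unfold thetaLoNum
  positivity

theorem hasDerivAt_sq_sub_sq (ν x : ℝ) : HasDerivAt (fun y => y ^ 2 - ν ^ 2) (2 * x) x := by
  simpa using (hasDerivAt_pow 2 x).sub_const (ν ^ 2)

theorem hasDerivAt_thetaLoNum (ν x : ℝ) :
    HasDerivAt (thetaLoNum ν) (thetaLoNumDeriv ν x) x := by
  refine ((((hasDerivAt_sq_sub_sq ν x).fun_pow 3).const_mul 8).fun_add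
    ((hasDerivAt_pow 2 x).fun_mul ((hasDerivAt_pow 2 x).add_const (4 * ν ^ 2)))).congr_deriv ?_
  rw [thetaLoNumDeriv]
  push_cast
  ring

theorem hasDerivAt_thetaLoNumDeriv (ν x : ℝ) :
    HasDerivAt (thetaLoNumDeriv ν)
      (48 * (x ^ 2 - ν ^ 2) ^ 2 + 192 * x ^ 2 * (x ^ 2 - ν ^ 2) + 12 * x ^ 2 + 8 * ν ^ 2) x := by
  refine (((((hasDerivAt_id' x).const_mul 48).fun_mul
    ((hasDerivAt_sq_sub_sq ν x).fun_pow 2)).fun_add ((hasDerivAt_pow 3 x).const_mul 4)).fun_add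
    ((hasDerivAt_id' x).const_mul (8 * ν ^ 2))).congr_deriv ?_
  push_cast
  ring

theorem hasDerivAt_thetaLo_s10 {ν x : ℝ} (hν : 0 ≤ ν) (hx : ν < x) :
    HasDerivAt (thetaLo ν) (thetaLoDeriv ν x) x := by
  have hx0 : 0 < x := hν.trans_lt hx
  have hW : 0 < x ^ 2 - ν ^ 2 := by nlinarith
  have hS := hasDerivAt_sqrt_sq_sub_sq hW
  have hs : 0 < Real.sqrt (x ^ 2 - ν ^ 2) := Real.sqrt_pos.2 hW
  have hss : Real.sqrt (x ^ 2 - ν ^ 2) ^ 2 = x ^ 2 - ν ^ 2 := Real.sq_sqrt hW.le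
  have hlt : ν / x < 1 := (div_lt_one hx0).2 hx
  have hge : 0 ≤ ν / x := by positivity
  have hq : Real.sqrt (1 - (ν / x) ^ 2) = Real.sqrt (x ^ 2 - ν ^ 2) / x := by
    rw [show 1 - (ν / x) ^ 2 = (x ^ 2 - ν ^ 2) / x ^ 2 by field_simp, Real.sqrt_div hW.le,
      Real.sqrt_sq hx0.le]
  have hA : HasDerivAt (fun y => Real.arccos (ν / y))
      (ν / (x * Real.sqrt (x ^ 2 - ν ^ 2))) x := by
    refine ((Real.hasDerivAt_arccos (by linarith) hlt.ne).comp x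
      ((hasDerivAt_inv hx0.ne').const_mul ν)).congr_deriv ?_
    rw [hq]
    field_simp
  have hR := (((hasDerivAt_pow 2 x).const_mul 3).add_const (2 * ν ^ 2)).fun_div
    ((hS.fun_pow 3).const_mul 24) (by positivity)
  refine (((hS.fun_sub (hA.const_mul ν)).sub_const (Real.pi / 4)).fun_sub hR).congr_deriv ?_
  have hν2 : ν * (ν / (x * Real.sqrt (x ^ 2 - ν ^ 2)))
      = ν ^ 2 / (x * Real.sqrt (x ^ 2 - ν ^ 2)) := by ring
  rw [thetaLoDeriv, thetaLoNum, hν2]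
  generalize Real.sqrt (x ^ 2 - ν ^ 2) = s at hs hss
  rw [show ν ^ 2 = x ^ 2 - s ^ 2 by rw [hss]; ring]
  push_cast
  field_simp
  ring

theorem hasDerivAt_thetaLoDeriv {ν x : ℝ} (hx : 0 < x) (hW : 0 < x ^ 2 - ν ^ 2) :
    HasDerivAt (thetaLoDeriv ν) (thetaLoDeriv ν x * thetaLoLogDeriv ν x) x := by
  have hs : 0 < Real.sqrt (x ^ 2 - ν ^ 2) := Real.sqrt_pos.2 hW
  have hss : Real.sqrt (x ^ 2 - ν ^ 2) ^ 2 = x ^ 2 - ν ^ 2 := Real.sq_sqrt hW.le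
  have hN := thetaLoNum_pos hW
  refine ((hasDerivAt_thetaLoNum ν x).fun_div (((hasDerivAt_id' x).const_mul 8).fun_mul
    ((hasDerivAt_sqrt_sq_sub_sq hW).fun_pow 5)) (by positivity)).congr_deriv ?_
  rw [thetaLoDeriv, thetaLoLogDeriv, ← hss, Real.sqrt_sq hs.le]
  push_cast
  field_simp
  ring

theorem hasDerivAt_thetaLoLogDeriv {ν x : ℝ} (hx : 0 < x) (hW : 0 < x ^ 2 - ν ^ 2) :
    HasDerivAt (thetaLoLogDeriv ν)
      ((48 * (x ^ 2 - ν ^ 2) ^ 2 + 192 * x ^ 2 * (x ^ 2 - ν ^ 2) + 12 * x ^ 2 + 8 * ν ^ 2)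
          / thetaLoNum ν x - (thetaLoNumDeriv ν x / thetaLoNum ν x) ^ 2
        + 1 / x ^ 2 - 5 / (x ^ 2 - ν ^ 2) + 10 * x ^ 2 / (x ^ 2 - ν ^ 2) ^ 2) x := by
  have hN := thetaLoNum_pos hW
  refine ((((hasDerivAt_thetaLoNumDeriv ν x).fun_div (hasDerivAt_thetaLoNum ν x) hN.ne').fun_sub
    ((hasDerivAt_const x (1 : ℝ)).fun_div (hasDerivAt_id' x) hx.ne')).fun_sub
    (((hasDerivAt_id' x).const_mul 5).fun_div (hasDerivAt_sq_sub_sq ν x) hW.ne')).congr_deriv ?_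
  field_simp
  ring

/-- The potential of `θlo_ν` dominates the Bessel potential on `(ν, ∞)`:
`V_{θlo_ν}(x) > 1 − (ν² − 1/4)/x²`. -/
theorem thetaLo_potential_gt_bessel_potential (ν : ℝ) (hν : 0 ≤ ν) :
    ∀ x, ν < x → 1 - (ν ^ 2 - 1 / 4) / x ^ 2 < potential (thetaLo ν) x := by
  intro x hx
  have hx0 : 0 < x := hν.trans_lt hx
  have hWpos : ∀ {y : ℝ}, ν < y → 0 < y ^ 2 - ν ^ 2 := fun h => by nlinarith
  have hev : ∀ᶠ y in nhds x, ν < y := lt_mem_nhds hx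
  have hW := hWpos hx
  have hN := thetaLoNum_pos hW
  have hs : 0 < Real.sqrt (x ^ 2 - ν ^ 2) := Real.sqrt_pos.2 hW
  have hg : 0 < thetaLoDeriv ν x := by unfold thetaLoDeriv; positivity
  rw [potential_eq_of_logDeriv (hev.mono fun y hy => hasDerivAt_thetaLo_s10 hν hy)
    (hev.mono fun y hy => hasDerivAt_thetaLoDeriv (hν.trans_lt hy) (hWpos hy))
    (hasDerivAt_thetaLoLogDeriv hx0 hW) hg.ne']
  have hg2 : thetaLoDeriv ν x ^ 2
      = thetaLoNum ν x ^ 2 / (64 * x ^ 2 * (x ^ 2 - ν ^ 2) ^ 5) := by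
    rw [thetaLoDeriv, div_pow, mul_pow, mul_pow, ← pow_mul, mul_comm 5 2, pow_mul,
      Real.sq_sqrt hW.le]
    norm_num
  rw [hg2, thetaLoLogDeriv]
  obtain ⟨u, hu⟩ : ∃ u, u = x ^ 2 - ν ^ 2 := ⟨_, rfl⟩
  have hNd : thetaLoNumDeriv ν x = x * (48 * u ^ 2 + 4 * u + 12 * ν ^ 2) := by
    rw [thetaLoNumDeriv, hu]; ring
  have hNe : thetaLoNum ν x = 8 * u ^ 3 + (u + ν ^ 2) * (u + 5 * ν ^ 2) := by
    rw [thetaLoNum, hu]; ring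
  rw [hNd, ← hu]
  rw [← hu] at hW
  have hx2 : x ^ 2 = u + ν ^ 2 := by rw [hu]; ring
  have hn : 0 ≤ ν ^ 2 := sq_nonneg ν
  generalize ν ^ 2 = n at *
  generalize thetaLoNum ν x = N at *
  rw [← sub_pos]
  have key : 0 < 625 * n ^ 7 + 2375 * u * n ^ 6 + 3525 * u ^ 2 * n ^ 5 + 2595 * u ^ 3 * n ^ 4
      + 2000 * u ^ 3 * n ^ 5 + 1011 * u ^ 4 * n ^ 3 + 5200 * u ^ 4 * n ^ 4 + 213 * u ^ 5 * n ^ 2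
      + 4128 * u ^ 5 * n ^ 3 + 23 * u ^ 6 * n + 1696 * u ^ 6 * n ^ 2 + 70720 * u ^ 6 * n ^ 3
      + u ^ 7 + 784 * u ^ 7 * n + 99008 * u ^ 7 * n ^ 2 + 16 * u ^ 8 + 33984 * u ^ 8 * n
      + 1600 * u ^ 9 := by positivity
  have hpos := div_pos key (by positivity : 0 < 64 * u ^ 5 * N ^ 2)
  have ht : 0 < u + n := by positivity
  have e1 : x * (48 * u ^ 2 + 4 * u + 12 * n) / N - 1 / x - 5 * x / u
      = x * ((48 * u ^ 2 + 4 * u + 12 * n) / N - 1 / (x ^ 2) - 5 / u) := by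
    field_simp
  have e2 : x * (48 * u ^ 2 + 4 * u + 12 * n) / N
      = x * ((48 * u ^ 2 + 4 * u + 12 * n) / N) := by ring
  rw [e1, e2, mul_pow, mul_pow, hx2]
  refine hpos.trans_eq ?_
  subst hNe
  field_simp
  ring
end

section
/- For every fixed ν ≥ 0, θlo_ν(x) − (x − (π/4)(2ν + 1) + (4ν² − 1)/(8x) + ν²(2ν² − 13)/(48x³)) = O(x⁻⁵) as x → +∞. -/
theorem abs_sqrt_one_sub_sub_le {y : ℝ} (h0 : 0 ≤ y) (h1 : y ≤ 1 / 4) :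
    |Real.sqrt (1 - y) - (1 - y / 2 - y ^ 2 / 8)| ≤ y ^ 3 := by
  have hs : 0 ≤ Real.sqrt (1 - y) := Real.sqrt_nonneg _
  have hsq : Real.sqrt (1 - y) ^ 2 = 1 - y := Real.sq_sqrt (by linarith)
  set s := Real.sqrt (1 - y)
  have hp : 3 / 4 ≤ s + (1 - y / 2 - y ^ 2 / 8) := by nlinarith
  have key : (s - (1 - y / 2 - y ^ 2 / 8)) * (s + (1 - y / 2 - y ^ 2 / 8))
      = -(y ^ 3 * (1 / 8 + y / 64)) := by
    linear_combination hsq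
  have h := congrArg abs key
  rw [abs_mul, abs_neg, abs_of_nonneg (by positivity : 0 ≤ y ^ 3 * (1 / 8 + y / 64)),
    abs_of_nonneg (by linarith : 0 ≤ s + (1 - y / 2 - y ^ 2 / 8))] at h
  have h3 : 0 ≤ y ^ 3 := by positivity
  have ha := abs_nonneg (s - (1 - y / 2 - y ^ 2 / 8))
  nlinarith [mul_le_mul_of_nonneg_left hp ha, mul_le_mul_of_nonneg_left h1 h3]

theorem abs_inv_sqrt_one_sub_sub_le {y : ℝ} (h0 : 0 ≤ y) (h1 : y ≤ 1 / 4) :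
    |(Real.sqrt (1 - y))⁻¹ - (1 + y / 2)| ≤ 2 * y ^ 2 := by
  have hs : 0 < Real.sqrt (1 - y) := Real.sqrt_pos.2 (by linarith)
  have hsq : Real.sqrt (1 - y) ^ 2 = 1 - y := Real.sq_sqrt (by linarith)
  set s := Real.sqrt (1 - y)
  have hr : 0 < s⁻¹ := by positivity
  have hrsq : s⁻¹ ^ 2 * (1 - y) = 1 := by rw [← hsq]; field_simp
  set r := s⁻¹
  have hp : 1 ≤ r + (1 + y / 2) := by linarith
  have key : (r - (1 + y / 2)) * ((r + (1 + y / 2)) * (1 - y)) = y ^ 2 * (3 / 4 + y / 4) := by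
    linear_combination hrsq
  have hp' : 3 / 4 ≤ (r + (1 + y / 2)) * (1 - y) := by nlinarith
  have h := congrArg abs key
  rw [abs_mul, abs_of_nonneg (by positivity : 0 ≤ y ^ 2 * (3 / 4 + y / 4)),
    abs_of_nonneg (by linarith : 0 ≤ (r + (1 + y / 2)) * (1 - y))] at h
  have ha := abs_nonneg (r - (1 + y / 2))
  nlinarith [mul_le_mul_of_nonneg_left hp' ha, mul_le_mul_of_nonneg_left h1 (sq_nonneg y)]

theorem abs_inv_sqrt_one_sub_pow_three_sub_le {y : ℝ} (h0 : 0 ≤ y) (h1 : y ≤ 1 / 4) :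
    |(Real.sqrt (1 - y))⁻¹ ^ 3 - (1 + 3 * y / 2)| ≤ 6 * y ^ 2 := by
  have hb := abs_inv_sqrt_one_sub_sub_le h0 h1
  have hs : 0 < Real.sqrt (1 - y) := Real.sqrt_pos.2 (by linarith)
  have hsq : Real.sqrt (1 - y) ^ 2 = 1 - y := Real.sq_sqrt (by linarith)
  set s := Real.sqrt (1 - y)
  have hrsq : s⁻¹ ^ 2 * (1 - y) = 1 := by rw [← hsq]; field_simp
  set r := s⁻¹
  have key : (r ^ 3 - (1 + 3 * y / 2)) * (1 - y) = (r - (1 + y / 2)) + 3 * y ^ 2 / 2 := by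
    linear_combination r * hrsq
  have h := congrArg abs key
  rw [abs_mul, abs_of_nonneg (by linarith : 0 ≤ 1 - y)] at h
  have h2 := abs_add_le (r - (1 + y / 2)) (3 * y ^ 2 / 2)
  rw [abs_of_nonneg (by positivity : 0 ≤ 3 * y ^ 2 / 2)] at h2
  have ha := abs_nonneg (r ^ 3 - (1 + 3 * y / 2))
  nlinarith [mul_le_mul_of_nonneg_left h1 ha]

theorem abs_arcsin_sub_le {u : ℝ} (h0 : 0 ≤ u) (h1 : u ≤ 1 / 2) :
    |Real.arcsin u - (u + u ^ 3 / 6)| ≤ 2 * u ^ 5 := by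
  have hd : ∀ v ∈ Set.Icc 0 u, HasDerivWithinAt (fun v => Real.arcsin v - (v + v ^ 3 / 6))
      ((Real.sqrt (1 - v ^ 2))⁻¹ - (1 + v ^ 2 / 2)) (Set.Icc 0 u) v := by
    rintro v ⟨hv0, hv1⟩
    have ha := Real.hasDerivAt_arcsin (x := v) (by linarith) (by linarith)
    have hp := (hasDerivAt_id v).add (((hasDerivAt_id v).pow 3).div_const 6)
    refine ((ha.sub hp).congr_deriv ?_).hasDerivWithinAt
    simp only [id, one_div]
    push_cast
    ring
  have hb : ∀ v ∈ Set.Icc 0 u, ‖(Real.sqrt (1 - v ^ 2))⁻¹ - (1 + v ^ 2 / 2)‖ ≤ 2 * u ^ 4 := by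
    rintro v ⟨hv0, hv1⟩
    have h := abs_inv_sqrt_one_sub_sub_le (sq_nonneg v) (by nlinarith)
    have hpow : v ^ 4 ≤ u ^ 4 := by gcongr
    rw [Real.norm_eq_abs]
    linarith
  have h := (convex_Icc 0 u).norm_image_sub_le_of_norm_hasDerivWithin_le hd hb
    (Set.left_mem_Icc.2 h0) (Set.right_mem_Icc.2 h0)
  simp only [Real.arcsin_zero, Real.norm_eq_abs, sub_zero, abs_of_nonneg h0] at h
  norm_num at h
  linarith

/-- Asymptotics of `θlo_ν` for a fixed `ν ≥ 0`:
`θlo_ν(x) = x − (π/4)(2ν + 1) + (4ν² − 1)/(8x) + ν²(2ν² − 13)/(48x³) + O(x⁻⁵)`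
as `x → +∞`. -/
theorem thetaLo_asymptotics (ν : ℝ) (hν : 0 ≤ ν) :
    Asymptotics.IsBigO Filter.atTop
      (fun x : ℝ => thetaLo ν x - (x - (Real.pi / 4) * (2 * ν + 1)
        + (4 * ν ^ 2 - 1) / (8 * x) + ν ^ 2 * (2 * ν ^ 2 - 13) / (48 * x ^ 3)))
      (fun x : ℝ => 1 / x ^ 5) := by
  refine Asymptotics.IsBigO.of_bound
    (ν ^ 6 + 2 * ν ^ 6 + (3 + 2 * ν ^ 2) / 24 * (6 * ν ^ 4) + ν ^ 4 / 8) ?_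
  filter_upwards [Filter.eventually_ge_atTop 1, Filter.eventually_ge_atTop (2 * ν)] with x hx1 hx2
  have hx : 0 < x := by linarith
  have hu0 : 0 ≤ ν / x := by positivity
  have hu1 : ν / x ≤ 1 / 2 := by rw [div_le_iff₀ hx]; linarith
  have hy1 : (ν / x) ^ 2 ≤ 1 / 4 := by nlinarith
  have b1 := abs_sqrt_one_sub_sub_le (sq_nonneg (ν / x)) hy1
  have b2 := abs_arcsin_sub_le hu0 hu1
  have b3 := abs_inv_sqrt_one_sub_pow_three_sub_le (sq_nonneg (ν / x)) hy1
  have hS : Real.sqrt (x ^ 2 - ν ^ 2) = x * Real.sqrt (1 - (ν / x) ^ 2) := by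
    rw [show x ^ 2 - ν ^ 2 = x ^ 2 * (1 - (ν / x) ^ 2) by field_simp,
      Real.sqrt_mul (sq_nonneg x), Real.sqrt_sq hx.le]
  have hs : 0 < Real.sqrt (1 - (ν / x) ^ 2) := Real.sqrt_pos.2 (by linarith)
  rw [thetaLo, hS, Real.arccos_eq_pi_div_two_sub_arcsin]
  set s := Real.sqrt (1 - (ν / x) ^ 2)
  set a := Real.arcsin (ν / x)
  set e₁ := s - (1 - (ν / x) ^ 2 / 2 - ((ν / x) ^ 2) ^ 2 / 8) with he₁
  set e₂ := a - (ν / x + (ν / x) ^ 3 / 6) with he₂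
  set e₃ := s⁻¹ ^ 3 - (1 + 3 * (ν / x) ^ 2 / 2) with he₃
  have hfrac : (3 * x ^ 2 + 2 * ν ^ 2) / (24 * (x * s) ^ 3)
      = (3 * x ^ 2 + 2 * ν ^ 2) / (24 * x ^ 3) * (e₃ + (1 + 3 * (ν / x) ^ 2 / 2)) := by
    rw [he₃, sub_add_cancel]
    field_simp
  have hdecomp : x * s - ν * (Real.pi / 2 - a) - Real.pi / 4
      - (3 * x ^ 2 + 2 * ν ^ 2) / (24 * (x * s) ^ 3)
      - (x - Real.pi / 4 * (2 * ν + 1) + (4 * ν ^ 2 - 1) / (8 * x)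
        + ν ^ 2 * (2 * ν ^ 2 - 13) / (48 * x ^ 3))
      = x * e₁ + ν * e₂ - (3 * x ^ 2 + 2 * ν ^ 2) / (24 * x ^ 3) * e₃ - ν ^ 4 / 8 / x ^ 5 := by
    rw [hfrac, show s = e₁ + (1 - (ν / x) ^ 2 / 2 - ((ν / x) ^ 2) ^ 2 / 8) by rw [he₁]; ring,
      show a = e₂ + (ν / x + (ν / x) ^ 3 / 6) by rw [he₂]; ring]
    field_simp
    ring
  have c1 : |x * e₁| ≤ ν ^ 6 / x ^ 5 := by
    rw [abs_mul, abs_of_pos hx]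
    calc x * |e₁| ≤ x * ((ν / x) ^ 2) ^ 3 := by gcongr
      _ = ν ^ 6 / x ^ 5 := by field_simp
  have c2 : |ν * e₂| ≤ 2 * ν ^ 6 / x ^ 5 := by
    rw [abs_mul, abs_of_nonneg hν]
    calc ν * |e₂| ≤ ν * (2 * (ν / x) ^ 5) := by gcongr
      _ = 2 * ν ^ 6 / x ^ 5 := by field_simp
  have c3 : |(3 * x ^ 2 + 2 * ν ^ 2) / (24 * x ^ 3) * e₃|
      ≤ (3 + 2 * ν ^ 2) / 24 * (6 * ν ^ 4) / x ^ 5 := by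
    rw [abs_mul, abs_of_nonneg (by positivity)]
    calc (3 * x ^ 2 + 2 * ν ^ 2) / (24 * x ^ 3) * |e₃|
        ≤ (3 * x ^ 2 + 2 * ν ^ 2 * x ^ 2) / (24 * x ^ 3) * (6 * ((ν / x) ^ 2) ^ 2) := by
          have hνx : 2 * ν ^ 2 ≤ 2 * ν ^ 2 * x ^ 2 :=
            le_mul_of_one_le_right (by positivity) (one_le_pow₀ hx1)
          exact mul_le_mul (by gcongr ?_ / _; linarith) b3 (abs_nonneg _) (by positivity)
      _ = (3 + 2 * ν ^ 2) / 24 * (6 * ν ^ 4) / x ^ 5 := by field_simp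
  have c4 : |ν ^ 4 / 8 / x ^ 5| = ν ^ 4 / 8 / x ^ 5 := abs_of_nonneg (by positivity)
  rw [hdecomp, Real.norm_eq_abs, Real.norm_eq_abs, abs_of_nonneg (by positivity : 0 ≤ 1 / x ^ 5)]
  calc |x * e₁ + ν * e₂ - (3 * x ^ 2 + 2 * ν ^ 2) / (24 * x ^ 3) * e₃ - ν ^ 4 / 8 / x ^ 5|
      ≤ |x * e₁| + |ν * e₂| + |(3 * x ^ 2 + 2 * ν ^ 2) / (24 * x ^ 3) * e₃|
        + |ν ^ 4 / 8 / x ^ 5| :=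
        (abs_sub _ _).trans (add_le_add_left ((abs_sub _ _).trans
          (add_le_add_left (abs_add_le _ _) _)) _)
    _ ≤ ν ^ 6 / x ^ 5 + 2 * ν ^ 6 / x ^ 5 + (3 + 2 * ν ^ 2) / 24 * (6 * ν ^ 4) / x ^ 5
        + ν ^ 4 / 8 / x ^ 5 := by rw [c4]; gcongr
    _ = _ := by ring
end
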